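/- arXiv:1808.09876 — 2 statements merged into one kernel-verified Lean document; each statement's English description precedes it below -/
import Mathlib

section
/- Let d be a squarefree integer, d ≠ 1, and suppose there exists a Galois extension L/ℚ with Galois group cyclic of order 4 such that ℚ(√d) is a subfield of L. Then d is a sum of two rational squares; in particular d > 0. -/
/-- An element of a Galois extension fixed by a generator of the Galois group lies in the base
field. -/
theorem exists_algebraMap_eq_of_generator_fixed {K L : Type*} [Field K] [Field L] [Algebra K L]
    [FiniteDimensional K L] [IsGalois K L] {σ : L ≃ₐ[K] L}
    (hσ : ∀ τ : L ≃ₐ[K] L, τ ∈ Subgroup.zpowers σ) {y : L} (hy : σ y = y) :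
    ∃ q : K, algebraMap K L q = y := by
  have hle : Subgroup.zpowers σ ≤ MulAction.stabilizer (L ≃ₐ[K] L) y :=
    Subgroup.zpowers_le.mpr hy
  exact (IsGalois.mem_range_algebraMap_iff_fixed y).mpr fun τ ↦ hle (hσ τ)

/-- A squarefree integer that is a rational square equals `1`. -/
theorem Squarefree.eq_one_of_ratCast_eq_sq {d : ℤ} (hd : Squarefree d) {q : ℚ}
    (hq : q ^ 2 = (d : ℚ)) : d = 1 := by
  have hsq : IsSquare (d : ℚ) := ⟨q, by rw [← hq, sq]⟩
  obtain ⟨n, rfl⟩ := Rat.isSquare_intCast_iff.mp hsq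
  rcases Int.isUnit_iff.mp (hd n dvd_rfl) with h | h <;> simp [h]

/-- If `d` has a square root negated by `σ`, where `σ` is a generator of order `4` of the Galois
group, then `d` is the quotient of a square by a sum of two squares. -/
theorem exists_sq_eq_mul_sq_add_four {K L : Type*} [Field K] [Field L] [Algebra K L]
    [FiniteDimensional K L] [IsGalois K L] {σ : L ≃ₐ[K] L}
    (hσ : ∀ τ : L ≃ₐ[K] L, τ ∈ Subgroup.zpowers σ) (hord : orderOf σ = 4)
    {d : K} {x : L} (hx : x ^ 2 = algebraMap K L d) (hσx : σ x = -x) :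
    ∃ a c : K, c ^ 2 = d * (a ^ 2 + 4) := by
  have hσ4 (y : L) : σ (σ (σ (σ y))) = y := by
    have h : σ ^ 4 = 1 := hord ▸ pow_orderOf_eq_one σ
    exact DFunLike.congr_fun h y
  obtain ⟨y, hy⟩ : ∃ y, σ (σ y) ≠ y := by
    by_contra! h
    have h2 : σ ^ 2 = 1 := AlgEquiv.ext h
    have := orderOf_dvd_of_pow_eq_one h2
    rw [hord] at this
    norm_num at this
  obtain ⟨z, hz, hσz⟩ : ∃ z : L, z ≠ 0 ∧ σ (σ z) = -z :=
    ⟨y - σ (σ y), sub_ne_zero.mpr hy.symm, by simp [hσ4]⟩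
  have hw : σ z ≠ 0 := by simpa using hz
  obtain ⟨t, s, hts, hst, hmul⟩ : ∃ t s : L, σ t = s ∧ σ s = t ∧ t * s = -1 := by
    refine ⟨σ z / z, -z / σ z, ?_, ?_, ?_⟩
    · simp [hσz]
    · simp [hσz, neg_div_neg_eq]
    · field_simp
  obtain ⟨a, ha⟩ := exists_algebraMap_eq_of_generator_fixed hσ (y := t + s)
    (by rw [map_add, hts, hst, add_comm])
  obtain ⟨c, hc⟩ := exists_algebraMap_eq_of_generator_fixed hσ (y := (t - s) * x)
    (by rw [map_mul, map_sub, hts, hst, hσx]; ring)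
  refine ⟨a, c, (algebraMap K L).injective ?_⟩
  simp only [map_mul, map_pow, map_add, map_ofNat, ha, hc, ← hx]
  linear_combination -4 * x ^ 2 * hmul

/-- Let `d` be a squarefree integer, `d ≠ 1`, and suppose there exists a Galois
extension `L/ℚ` with cyclic Galois group of order 4 containing a square root
of `d` (i.e. `ℚ(√d) ⊆ L`). Then `d` is a sum of two rational squares; in
particular `d > 0`. -/
theorem stmt_6 (d : ℤ) (hd : Squarefree d) (hd1 : d ≠ 1)
    (L : Type*) [Field L] [Algebra ℚ L] [FiniteDimensional ℚ L] [IsGalois ℚ L]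
    (hcyc : IsCyclic (L ≃ₐ[ℚ] L)) (hcard : Nat.card (L ≃ₐ[ℚ] L) = 4)
    (x : L) (hx : x ^ 2 = algebraMap ℚ L (d : ℚ)) :
    (∃ a b : ℚ, (d : ℚ) = a ^ 2 + b ^ 2) ∧ 0 < d := by
  obtain ⟨σ, hσ⟩ := hcyc.exists_generator
  have hord : orderOf σ = 4 := by rw [orderOf_eq_card_of_forall_mem_zpowers hσ, hcard]
  have hσx : σ x = -x := by
    have hsq : σ x ^ 2 = x ^ 2 := by rw [← map_pow, hx, AlgEquiv.commutes]
    refine (sq_eq_sq_iff_eq_or_eq_neg.mp hsq).resolve_left fun h ↦ hd1 ?_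
    obtain ⟨q, rfl⟩ := exists_algebraMap_eq_of_generator_fixed hσ h
    exact hd.eq_one_of_ratCast_eq_sq ((algebraMap ℚ L).injective (by rw [map_pow, hx]))
  obtain ⟨a, c, hac⟩ := exists_sq_eq_mul_sq_add_four hσ hord hx hσx
  have hd0 : (d : ℚ) ≠ 0 := Int.cast_ne_zero.mpr hd.ne_zero
  have ha : a ^ 2 + 4 ≠ 0 := by positivity
  have hc : c ≠ 0 := by
    rintro rfl
    exact mul_ne_zero hd0 ha (by simpa using hac.symm)
  have hsum : (d : ℚ) = (a * d / c) ^ 2 + (2 * d / c) ^ 2 := by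
    field_simp
    linear_combination hac
  refine ⟨⟨_, _, hsum⟩, ?_⟩
  have hnonneg : (0 : ℚ) ≤ d := hsum ▸ by positivity
  exact_mod_cast lt_of_le_of_ne hnonneg hd0.symm
end

section
/- Fix a positive integer n and a finite set S of prime numbers. Then the set of intermediate fields ℚ ⊆ K ⊆ ℚ̄ such that [K : ℚ] ≤ n and K/ℚ is unramified outside S (i.e., every prime p that ramifies in K lies in S) is finite. -/
open NumberField

/-- The trace of a nonzero idempotent matrix over a local ring is a positive integer bounded by
the size of the matrix. -/
theorem Matrix.exists_trace_eq_natCast_of_isIdempotentElem {R ι : Type*} [CommRing R]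
    [IsLocalRing R] [Fintype ι] [DecidableEq ι] {E : Matrix ι ι R} (hE : IsIdempotentElem E)
    (hE0 : E ≠ 0) : ∃ r : ℕ, 1 ≤ r ∧ r ≤ Fintype.card ι ∧ E.trace = r := by
  set f := Matrix.toLin' E with hf
  have hfi : IsIdempotentElem f := by
    rw [IsIdempotentElem, Module.End.mul_eq_comp, hf, ← Matrix.toLin'_mul, hE.eq]
  have hproj : LinearMap.IsProj (LinearMap.range f) f :=
    LinearMap.isProj_range_iff_isIdempotentElem f |>.2 hfi
  have hc : IsCompl (LinearMap.range f) (LinearMap.ker f) := hproj.isCompl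
  have hr : Module.Projective R (LinearMap.range f) :=
    Module.Projective.of_split (LinearMap.range f).subtype hproj.codRestrict <| by
      ext x; simp
  have hk : Module.Projective R (LinearMap.ker f) :=
    Module.Projective.of_split (LinearMap.ker f).subtype
      ((LinearMap.ker f).projectionOnto (LinearMap.range f) hc.symm) <| by
      ext x; simp
  have : Module.Finite R (LinearMap.range f) := inferInstance
  have : Module.Finite R (LinearMap.ker f) := Module.Finite.of_surjective
    ((LinearMap.ker f).projectionOnto (LinearMap.range f) hc.symm)
    (Submodule.projectionOnto_surjective hc.symm)
  have : Module.Free R (LinearMap.range f) := Module.free_of_flat_of_isLocalRing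
  have : Module.Free R (LinearMap.ker f) := Module.free_of_flat_of_isLocalRing
  refine ⟨Module.finrank R (LinearMap.range f), ?_, ?_, ?_⟩
  · have : Nontrivial (LinearMap.range f) := by
      rw [Submodule.nontrivial_iff_ne_bot, ne_eq, LinearMap.range_eq_bot]
      simpa [hf] using hE0
    exact Module.finrank_pos_iff_of_free R _ |>.2 this
  · have h := (Submodule.prodEquivOfIsCompl _ _ hc).finrank_eq
    rw [Module.finrank_prod, Module.finrank_pi] at h
    omega
  · rw [← hproj.trace, hf, Matrix.trace_toLin'_eq]

theorem ZMod.isLocalRing_prime_pow (p : ℕ) [Fact p.Prime] {N : ℕ} (hN : N ≠ 0) :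
    IsLocalRing (ZMod (p ^ N)) := by
  have : Fact (1 < p ^ N) := ⟨Nat.one_lt_pow hN (Fact.out : p.Prime).one_lt⟩
  exact IsLocalRing.of_surjective' (PadicInt.toZModPow (p := p) N) (ZMod.ringHom_surjective _)

/-- The trace of an integer of `B` which is a nonzero idempotent modulo `p ^ N` is not divisible
by `p ^ N`, once `p ^ N` exceeds the rank of `B`. -/
theorem not_prime_pow_dvd_trace {B : Type*} [CommRing B] [Module.Free ℤ B] [Module.Finite ℤ B]
    {p N : ℕ} (hp : p.Prime) (hN : N ≠ 0) (hpN : Module.finrank ℤ B < p ^ N) {y : B}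
    (hy : (p : B) ^ N ∣ y * y - y) (hy0 : ¬ (p : B) ^ N ∣ y) :
    ¬ (p : ℤ) ^ N ∣ Algebra.trace ℤ B y := by
  classical
  have := Fact.mk hp
  have := ZMod.isLocalRing_prime_pow p hN
  let b := Module.Free.chooseBasis ℤ B
  let φ : B →+* Matrix _ _ (ZMod (p ^ N)) :=
    (Int.castRingHom (ZMod (p ^ N))).mapMatrix.comp (Algebra.leftMulMatrix b).toRingHom
  have hφ (x : B) : φ x = 0 ↔ (p : B) ^ N ∣ x := by
    constructor
    · intro h
      have hdvd (i j) : ∃ c, Algebra.leftMulMatrix b x i j = (p : ℤ) ^ N * c := by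
        have := congr_fun (congr_fun h i) j
        simp only [φ, RingHom.comp_apply, RingHom.mapMatrix_apply, Matrix.map_apply,
          Matrix.zero_apply, eq_intCast, ZMod.intCast_zmod_eq_zero_iff_dvd] at this
        exact (by simpa using this : (p : ℤ) ^ N ∣ _)
      choose c hc using hdvd
      refine ⟨Matrix.toLin b b (Matrix.of c) 1, ?_⟩
      have : Algebra.leftMulMatrix b x = (p : ℤ) ^ N • Matrix.of c := by
        ext i j; simp [hc, -zsmul_eq_mul]
      have h2 := congr_arg (fun M ↦ Matrix.toLin b b M 1) this
      simp only [Algebra.leftMulMatrix_apply, Matrix.toLin_toMatrix, map_smul,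
        Algebra.coe_lmul_eq_mul, LinearMap.mul_apply', mul_one, LinearMap.smul_apply] at h2
      rw [h2, zsmul_eq_mul]
      push_cast
      rfl
    · rintro ⟨w, rfl⟩
      rw [map_mul, map_pow, map_natCast, ← Nat.cast_pow, ← nsmul_eq_mul]
      ext i j
      rw [Matrix.smul_apply, nsmul_eq_mul, ZMod.natCast_self, zero_mul, Matrix.zero_apply]
  have hid : IsIdempotentElem (φ y) := by
    rw [IsIdempotentElem, ← sub_eq_zero, ← map_mul, ← map_sub, hφ]; exact hy
  obtain ⟨r, hr1, hr2, hr⟩ :=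
    Matrix.exists_trace_eq_natCast_of_isIdempotentElem hid (mt (hφ y).1 hy0)
  rw [← Module.finrank_eq_card_basis b] at hr2
  have htr : (φ y).trace = ((Algebra.trace ℤ B y : ℤ) : ZMod (p ^ N)) := by
    rw [Algebra.trace_eq_matrix_trace b]
    simp [φ, Matrix.trace]
  intro hdvd
  rw [← Nat.cast_pow, ← ZMod.intCast_zmod_eq_zero_iff_dvd, ← htr, hr,
    ZMod.natCast_eq_zero_iff] at hdvd
  exact absurd (Nat.le_of_dvd hr1 hdvd) (by omega)

/-- If `I * J = (m)` and `I` divides the different, then `m` divides the trace of every element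
of `J`. -/
theorem dvd_trace_of_dvd_differentIdeal (K : Type*) [Field K] [NumberField K]
    {m : ℤ} (hm : m ≠ 0) {I J : Ideal (𝓞 K)} (hIJ : Ideal.span {(m : 𝓞 K)} = I * J)
    (hI : I ∣ differentIdeal ℤ (𝓞 K)) {y : 𝓞 K} (hy : y ∈ J) :
    m ∣ Algebra.trace ℤ (𝓞 K) y := by
  have hmK : (m : K) ≠ 0 := by exact_mod_cast hm
  have hI0 : I ≠ ⊥ := by
    rintro rfl
    simp [hm] at hIJ
  rw [Ideal.dvd_iff_le, differentialIdeal_le_iff (K := ℚ) (L := K) hI0,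
    Submodule.map_le_iff_le_comap] at hI
  have hmem : (y : K) / m ∈ (I⁻¹ : FractionalIdeal (nonZeroDivisors (𝓞 K)) K) := by
    rw [FractionalIdeal.mem_inv_iff (by simpa using hI0)]
    intro z hz
    obtain ⟨z, hzI, rfl⟩ := (FractionalIdeal.mem_coeIdeal _).1 hz
    have : z * y ∈ Ideal.span {(m : 𝓞 K)} := hIJ ▸ Ideal.mul_mem_mul hzI hy
    obtain ⟨w, hw⟩ := Ideal.mem_span_singleton.1 this
    rw [FractionalIdeal.mem_one_iff]
    refine ⟨w, ?_⟩
    have := congr_arg (algebraMap (𝓞 K) K) hw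
    simp only [map_mul, map_intCast] at this
    field_simp
    linear_combination -this
  have h := hI hmem
  simp only [Submodule.mem_comap, Submodule.mem_one, LinearMap.coe_restrictScalars] at h
  obtain ⟨t, ht⟩ := h
  refine ⟨t, ?_⟩
  have hsm : (y : K) = (m : ℚ) • ((y : K) / m) := by
    rw [Algebra.smul_def]; simp; field_simp
  have h2 : Algebra.trace ℚ K y = (Algebra.trace ℤ (𝓞 K) y : ℤ) := by
    rw [Algebra.coe_trace_int]
  rw [hsm, map_smul, ← ht] at h2
  simp only [smul_eq_mul, eq_intCast] at h2
  exact_mod_cast h2.symm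

/-- The exponent of a prime `P ∣ p` in the different is smaller than in `p ^ N`, where `N` is any
exponent for which `p ^ N` exceeds the degree. -/
theorem emultiplicity_differentIdeal_le (K : Type*) [Field K] [NumberField K]
    {p N : ℕ} (hp : p.Prime) (hpN : Module.finrank ℚ K < p ^ N) {P : Ideal (𝓞 K)}
    (hP : Prime P) (hpP : (p : 𝓞 K) ∈ P) :
    emultiplicity P (differentIdeal ℤ (𝓞 K)) ≤ emultiplicity P (Ideal.span {(p : 𝓞 K) ^ N}) := by
  have hPp := Ideal.isPrime_of_prime hP
  have hPm : P.IsMaximal := hPp.isMaximal hP.ne_zero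
  have hN : N ≠ 0 := by
    rintro rfl
    have : 0 < Module.finrank ℚ K := Module.finrank_pos
    simp at hpN; omega
  have h0 : Ideal.span {(p : 𝓞 K) ^ N} ≠ ⊥ := by simp [hp.ne_zero]
  obtain ⟨J, hJ, hPJ⟩ := Ideal.eq_prime_pow_mul_coprime h0 P
  have hk : emultiplicity P (Ideal.span {(p : 𝓞 K) ^ N}) =
      Multiset.count P (UniqueFactorizationMonoid.normalizedFactors (Ideal.span {(p : 𝓞 K) ^ N})) := by
    rw [UniqueFactorizationMonoid.emultiplicity_eq_count_normalizedFactors hP.irreducible h0,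
      normalize_eq]
  generalize Multiset.count P _ = k at hPJ hk
  rw [hk]
  have hk0 : k ≠ 0 := by
    intro h
    rw [h, Nat.cast_zero, emultiplicity_eq_zero, Ideal.dvd_span_singleton] at hk
    exact hk (Ideal.pow_mem_of_mem _ hpP _ (Nat.pos_of_ne_zero hN))
  by_contra! hlt
  have hdvd : P ^ k ∣ differentIdeal ℤ (𝓞 K) := pow_dvd_of_le_emultiplicity hlt.le
  have hco : IsCoprime (P ^ k) J := (Ideal.isCoprime_iff_sup_eq.2 hJ).pow_left
  obtain ⟨x, hx, y, hy, hxy⟩ := Ideal.isCoprime_iff_exists.1 hco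
  refine not_prime_pow_dvd_trace (B := 𝓞 K) hp hN (by rwa [RingOfIntegers.rank]) (y := y) ?_ ?_
    (dvd_trace_of_dvd_differentIdeal K
      (m := (p : ℤ) ^ N) (pow_ne_zero _ (by exact_mod_cast hp.ne_zero)) (by simpa using hPJ)
      hdvd hy)
  · rw [← Ideal.mem_span_singleton, hPJ,
      show y * y - y = -(x * y) by linear_combination y * hxy]
    exact neg_mem (Ideal.mul_mem_mul hx hy)
  · intro h
    have hyP : y ∈ P ^ k := by
      rw [← Ideal.mem_span_singleton, hPJ] at h
      exact (Ideal.mul_le_left : P ^ k * J ≤ P ^ k) h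
    have h1 : (1 : 𝓞 K) ∈ P := by
      rw [← hxy]
      exact Ideal.pow_le_self hk0 (add_mem hx hyP)
    exact hPp.ne_top ((Ideal.eq_top_iff_one _).2 h1)

/-- The discriminant of a number field of degree at most `n` unramified outside `S` is bounded. -/
theorem NumberField.abs_discr_le_of_forall_prime_dvd (K : Type*) [Field K] [NumberField K]
    {n : ℕ} (hn : Module.finrank ℚ K ≤ n) {S : Finset ℕ} (hS : ∀ p ∈ S, p.Prime)
    (h : ∀ p : ℕ, p.Prime → (p : ℤ) ∣ discr K → p ∈ S) :
    |discr K| ≤ ((∏ p ∈ S, p ^ n) ^ n : ℕ) := by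
  set c : ℕ := ∏ p ∈ S, p ^ n
  have hc0 : c ≠ 0 := Finset.prod_ne_zero_iff.2 fun p hp ↦ pow_ne_zero _ (hS p hp).ne_zero
  have hdvd : differentIdeal ℤ (𝓞 K) ∣ Ideal.span {(c : 𝓞 K)} := by
    rw [UniqueFactorizationMonoid.dvd_iff_emultiplicity_le differentIdeal_ne_bot]
    intro P hP
    by_cases hPD : P ∣ differentIdeal ℤ (𝓞 K)
    · have hPp := Ideal.isPrime_of_prime hP
      have hdP : ((discr K : ℤ) : 𝓞 K) ∈ P :=
        Ideal.dvd_iff_le.1 hPD (discr_mem_differentIdeal K (𝓞 K))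
      obtain ⟨p, hp, hpd, hpP⟩ : ∃ p : ℕ, p.Prime ∧ (p : ℤ) ∣ discr K ∧ (p : 𝓞 K) ∈ P := by
        have hnat : (((discr K).natAbs : ℕ) : 𝓞 K) ∈ P := by
          rcases Int.natAbs_eq (discr K) with e | e <;> rw [e] at hdP
          · rwa [Int.cast_natCast] at hdP
          · rwa [Int.cast_neg, neg_mem_iff, Int.cast_natCast] at hdP
        rw [← Nat.prod_primeFactorsList (Int.natAbs_ne_zero.2 (discr_ne_zero K)),
          ← Multiset.prod_coe, Nat.cast_multiset_prod,
          hPp.multiset_prod_mem_iff_exists_mem] at hnat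
        obtain ⟨_, hp, hpP⟩ := hnat
        obtain ⟨p, hpl, rfl⟩ := Multiset.mem_map.1 hp
        rw [Multiset.mem_coe] at hpl
        exact ⟨p, Nat.prime_of_mem_primeFactorsList hpl,
          Int.natCast_dvd.2 (Nat.dvd_of_mem_primeFactorsList hpl), hpP⟩
      have hpn : Module.finrank ℚ K < p ^ n := hn.trans_lt (Nat.lt_pow_self hp.one_lt)
      refine (emultiplicity_differentIdeal_le K hp hpn hP hpP).trans
        (emultiplicity_le_emultiplicity_of_dvd_right ?_)
      rw [Ideal.dvd_iff_le, Ideal.span_singleton_le_span_singleton, ← Nat.cast_pow]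
      exact Nat.cast_dvd_cast (Finset.dvd_prod_of_mem _ (h p hp hpd))
    · rw [emultiplicity_eq_zero.2 hPD]; exact zero_le
  have hN := Ideal.absNorm_dvd_absNorm_of_le (Ideal.dvd_iff_le.1 hdvd)
  rw [absNorm_differentIdeal K (𝓞 K), Ideal.absNorm_span_singleton,
    ← map_natCast (algebraMap ℤ (𝓞 K)),
    Algebra.norm_algebraMap, RingOfIntegers.rank] at hN
  have hle := Nat.le_of_dvd (by simp [hc0, Nat.pos_iff_ne_zero]) hN
  rw [Int.abs_eq_natAbs]
  norm_cast
  refine hle.trans ?_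
  rw [Int.natAbs_pow, Int.natAbs_natCast]
  exact Nat.pow_le_pow_right (Nat.pos_of_ne_zero hc0) hn

/-- **Hermite–Minkowski.** Fix a positive integer `n` and a finite set `S` of
prime numbers. The set of intermediate fields `ℚ ⊆ K ⊆ ℚ̄` with `[K : ℚ] ≤ n`
that are unramified outside `S` (every prime dividing the discriminant of `K`
lies in `S`) is finite. -/
theorem stmt_8 (n : ℕ) (hn : 0 < n) (S : Finset ℕ) (hS : ∀ p ∈ S, p.Prime) :
    {K : IntermediateField ℚ (AlgebraicClosure ℚ) |
      ∃ h : FiniteDimensional ℚ K,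
        Module.finrank ℚ K ≤ n ∧
        ∀ p : ℕ, p.Prime →
          (p : ℤ) ∣ @NumberField.discr K _ (@NumberField.mk K _ inferInstance h) →
          p ∈ S}.Finite := by
  refine ((NumberField.finite_of_discr_bdd (AlgebraicClosure ℚ)
    ((∏ p ∈ S, p ^ n) ^ n : ℕ)).image Subtype.val).subset ?_
  rintro K ⟨hK, hle, hram⟩
  have : NumberField K := @NumberField.mk K _ inferInstance hK
  exact ⟨⟨K, hK⟩, NumberField.abs_discr_le_of_forall_prime_dvd K hle hS hram, rfl⟩
end
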